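/- arXiv:2508.02301 — 4 statements merged into one kernel-verified Lean document; each statement's English description precedes it below -/
import Mathlib

section
/- Every k-safety hyperproperty is monitorable: if H is a hyperproperty such that for every set V of infinite traces with V ∉ H there exists an observation O₀ with at most k traces such that O₀ ⪯ V and every set V' of infinite traces with O₀ ⪯ V' satisfies V' ∉ H, then every observation O has an observation O' with O ⪯ O' and O' ∈ Good(H) ∪ Bad(H). -/
/-- A finite trace `u` is a prefix of an infinite trace `τ`. -/
def IsPrefixInf {σ : Type*} (u : List σ) (τ : ℕ → σ) : Prop :=
  ∀ i : ℕ, (h : i < u.length) → u.get ⟨i, h⟩ = τ i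

/-- Hoare prefix order between sets of finite traces. -/
def HoareFin {σ : Type*} (S V : Set (List σ)) : Prop :=
  ∀ u ∈ S, ∃ τ ∈ V, u <+: τ

/-- Hoare prefix order between a set of finite traces and a set of infinite traces. -/
def HoareInf {σ : Type*} (S : Set (List σ)) (V : Set (ℕ → σ)) : Prop :=
  ∀ u ∈ S, ∃ τ ∈ V, IsPrefixInf u τ

/-- The observations that permanently satisfy the hyperproperty `H`. -/
def Good {σ : Type*} (H : Set (Set (ℕ → σ))) : Set (Set (List σ)) :=
  {O | O.Finite ∧ ∀ V : Set (ℕ → σ), HoareInf O V → V ∈ H}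

/-- The observations that permanently violate the hyperproperty `H`. -/
def Bad {σ : Type*} (H : Set (Set (ℕ → σ))) : Set (Set (List σ)) :=
  {O | O.Finite ∧ ∀ V : Set (ℕ → σ), HoareInf O V → V ∉ H}

theorem kSafety_monitorable {σ : Type*} (k : ℕ) (H : Set (Set (ℕ → σ)))
    (hksafe : ∀ V : Set (ℕ → σ), V ∉ H →
      ∃ O₀ : Finset (List σ), O₀.card ≤ k ∧ HoareInf ↑O₀ V ∧
        ∀ V' : Set (ℕ → σ), HoareInf ↑O₀ V' → V' ∉ H) :
    ∀ O : Set (List σ), O.Finite →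
      ∃ O' : Set (List σ), O'.Finite ∧ HoareFin O O' ∧ O' ∈ Good H ∪ Bad H := by
  intro O hO
  by_cases huniv : Set.univ ∈ H
  · refine ⟨O, hO, fun u hu => ⟨u, hu, List.prefix_rfl⟩, Or.inl ⟨hO, fun V _ => ?_⟩⟩
    by_contra hV
    obtain ⟨O₀, -, hO₀, hbad⟩ := hksafe V hV
    refine hbad Set.univ (fun u hu => ?_) huniv
    obtain ⟨τ, -, hτ⟩ := hO₀ u hu
    exact ⟨τ, Set.mem_univ τ, hτ⟩
  · obtain ⟨O₀, -, -, hbad⟩ := hksafe Set.univ huniv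
    have hfin : (O ∪ ↑O₀).Finite := hO.union O₀.finite_toSet
    exact ⟨O ∪ ↑O₀, hfin, fun u hu => ⟨u, Or.inl hu, List.prefix_rfl⟩,
      Or.inr ⟨hfin, fun V hV => hbad V fun u hu => hV u (Or.inr hu)⟩⟩
end

section
/- Dichotomy for universally quantified hyperproperties (universal half of the monitorability theorem): let n be a natural number and P a predicate on n-tuples of finite traces, and let H be the hyperproperty consisting of all sets T of finite traces such that every n-tuple of traces drawn from T satisfies P. Then either every set of finite traces belongs to H, or for every observation O there exists an observation O' with O ⊆ O' such that every set T of finite traces with O' ⊆ T satisfies T ∉ H (i.e., O' is a bad prefix of H, witnessing monitorability of H for violation). -/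
theorem universal_dichotomy {σ : Type*} (n : ℕ)
    (P : (Fin n → List σ) → Prop) :
    (∀ T : Set (List σ),
        T ∈ {T : Set (List σ) | ∀ t : Fin n → List σ, (∀ i, t i ∈ T) → P t}) ∨
    (∀ O : Set (List σ), O.Finite →
        ∃ O' : Set (List σ), O'.Finite ∧ O ⊆ O' ∧
          ∀ T : Set (List σ), O' ⊆ T →
            T ∉ {T : Set (List σ) | ∀ t : Fin n → List σ, (∀ i, t i ∈ T) → P t}) := by
  by_cases h : ∀ t, P t
  · exact Or.inl fun T t _ => h t
  · obtain ⟨t, ht⟩ := not_forall.mp h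
    refine Or.inr fun O hO =>
      ⟨O ∪ Set.range t, hO.union (Set.finite_range t), Set.subset_union_left, fun T hT hmem => ?_⟩
    exact ht (hmem t fun i => hT (Or.inr ⟨i, rfl⟩))
end

section
/- Dichotomy for existentially quantified hyperproperties (existential half of the monitorability theorem): let n be a natural number and P a predicate on n-tuples of finite traces, and let H be the hyperproperty consisting of all sets T of finite traces such that there exists an n-tuple of traces drawn from T satisfying P. Then either no set of finite traces belongs to H, or for every observation O there exists an observation O' with O ⊆ O' such that every set T of finite traces with O' ⊆ T satisfies T ∈ H (i.e., O' is a good prefix of H, witnessing monitorability of H for satisfaction). -/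
theorem existential_dichotomy {σ : Type*} (n : ℕ)
    (P : (Fin n → List σ) → Prop) :
    (∀ T : Set (List σ),
        T ∉ {T : Set (List σ) | ∃ t : Fin n → List σ, (∀ i, t i ∈ T) ∧ P t}) ∨
    (∀ O : Set (List σ), O.Finite →
        ∃ O' : Set (List σ), O'.Finite ∧ O ⊆ O' ∧
          ∀ T : Set (List σ), O' ⊆ T →
            T ∈ {T : Set (List σ) | ∃ t : Fin n → List σ, (∀ i, t i ∈ T) ∧ P t}) := by
  by_cases h : ∃ t, P t
  · obtain ⟨t, ht⟩ := h
    refine Or.inr fun O hO => ⟨O ∪ Set.range t, hO.union (Set.finite_range t),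
      Set.subset_union_left, fun T hT => ⟨t, fun i => hT (Or.inr ⟨i, rfl⟩), ht⟩⟩
  · exact Or.inl fun _ ⟨t, _, ht⟩ => h ⟨t, ht⟩
end

section
/- Stutter reduction is monotone with respect to the prefix order on finite traces: for any type Σ with decidable equality and lists u, v over Σ, if u is a prefix of v, then the stutter reduction of u (the list obtained by collapsing every maximal block of consecutive equal elements to a single element, i.e., List.destutter with the relation ≠) is a prefix of the stutter reduction of v. In particular, the prefix relation on finite traces implies the stutter-prefix relation ≾, where u ≾ v is defined as: the stutter reduction of u is a prefix of the stutter reduction of v. -/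
/-- The stutter-prefix relation: `u ≾ v` iff the stutter reduction of `u`
is a prefix of the stutter reduction of `v`. -/
def StutterPrefix {σ : Type*} [DecidableEq σ] (u v : List σ) : Prop :=
  u.destutter (· ≠ ·) <+: v.destutter (· ≠ ·)

theorem List.destutter'_prefix_destutter'_append {α : Type*} (R : α → α → Prop)
    [DecidableRel R] (l t : List α) (a : α) :
    l.destutter' R a <+: (l ++ t).destutter' R a := by
  induction l generalizing a with
  | nil =>
    induction t with
    | nil => exact List.prefix_rfl
    | cons b t ih =>
      by_cases h : R a b
      · simp [h]
      · simpa [h] using ih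
  | cons b l ih =>
    by_cases h : R a b
    · simpa [h] using ih b
    · simpa [h] using ih a

theorem List.IsPrefix.destutter {α : Type*} (R : α → α → Prop) [DecidableRel R]
    {u v : List α} (h : u <+: v) : u.destutter R <+: v.destutter R := by
  obtain ⟨t, rfl⟩ := h
  cases u with
  | nil => exact List.nil_prefix
  | cons a l => exact List.destutter'_prefix_destutter'_append R l t a

theorem destutter_prefix_mono {σ : Type*} [DecidableEq σ] (u v : List σ)
    (h : u <+: v) :
    u.destutter (· ≠ ·) <+: v.destutter (· ≠ ·) ∧ StutterPrefix u v := by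
  exact ⟨h.destutter _, h.destutter _⟩
end
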